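/- Let d ≥ 1, let σ∥, v ∈ ℝ^d, b > 0 and c > 0, and suppose C∥ = σ∥ · max(b, ‖σ∥ + c·v‖) - b·(σ∥ + c·v) = 0. Then the Coulomb friction conditions hold: ‖σ∥‖ ≤ b, if ‖σ∥‖ < b then v = 0, and there exists λ ≥ 0 such that v = λ·σ∥ (the tangential slip increment is parallel to the tangential traction with nonnegative proportionality factor). -/

import Mathlib

/-- If the tangential complementarity function vanishes, then the Coulomb
friction conditions hold: `‖σ∥‖ ≤ b`, slip only occurs at the friction bound,
and the slip increment is parallel to the tangential traction with a
nonnegative proportionality factor. -/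
theorem tangential_complementarity_implies_coulomb
    (d : ℕ) (hd : 1 ≤ d) (σ v : EuclideanSpace ℝ (Fin d)) (b c : ℝ)
    (hb : 0 < b) (hc : 0 < c)
    (h : (max b ‖σ + c • v‖) • σ - b • (σ + c • v) = 0) :
    ‖σ‖ ≤ b ∧ (‖σ‖ < b → v = 0) ∧ ∃ l : ℝ, 0 ≤ l ∧ v = l • σ := by
  have hM : b ≤ max b ‖σ + c • v‖ := le_max_left _ _
  have hN : ‖σ + c • v‖ ≤ max b ‖σ + c • v‖ := le_max_right _ _
  have hcase : max b ‖σ + c • v‖ = b ∨ max b ‖σ + c • v‖ = ‖σ + c • v‖ := max_choice _ _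
  generalize max b ‖σ + c • v‖ = M at h hM hN hcase
  have hM0 : 0 < M := lt_of_lt_of_le hb hM
  have h1 : M • σ = b • (σ + c • v) := sub_eq_zero.mp h
  have hnorm : M * ‖σ‖ = b * ‖σ + c • v‖ := by
    have h2 := congrArg norm h1
    rwa [norm_smul, norm_smul, Real.norm_of_nonneg hM0.le, Real.norm_of_nonneg hb.le] at h2
  have hv : v = ((M - b) / (b * c)) • σ := by
    have h3 : (b * c) • v = (M - b) • σ := by
      rw [sub_smul, h1, smul_add, smul_smul]
      abel
    have hbc : b * c ≠ 0 := (mul_pos hb hc).ne'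
    rw [div_eq_inv_mul, mul_smul, ← h3, inv_smul_smul₀ hbc]
  refine ⟨?_, ?_, (M - b) / (b * c), ?_, hv⟩
  · nlinarith
  · intro hlt
    rcases hcase with e | e
    · rw [hv, e]
      simp
    · exfalso
      rw [← e] at hnorm
      nlinarith
  · exact div_nonneg (sub_nonneg.mpr hM) (mul_pos hb hc).le
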